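/- arXiv:2004.02239 — 2 statements merged into one kernel-verified Lean document; each statement's English description precedes it below -/
import Mathlib

section
/- Let M be a finitely presented 2-parameter persistence module. Then for all α ∈ ℕ², the second bigraded Betti number satisfies β₂^M(α+e₁+e₂) = dim{w ∈ M_α : ᴹφ_α^{α+e₁}(w) = 0 and ᴹφ_α^{α+e₂}(w) = 0}; in particular β₂^M(β) = 0 whenever β has a zero coordinate. -/
/-- The free 2-parameter persistence module on a finite (multi)set of generators,
indexed by `ι` with degrees `deg`: at grade `α` it is the direct sum of one copy of `F`
for each generator `i` with `deg i ≤ α` (product order on `ℕ × ℕ`). -/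
abbrev FreeMod (F : Type*) [Field F] (ι : Type*) (deg : ι → ℕ × ℕ) (α : ℕ × ℕ) : Type _ :=
  {i : ι // deg i ≤ α} → F

/-- Structure map of the free module: identity on each summand present at the source,
new summands get `0`. -/
def freeMap (F : Type*) [Field F] (ι : Type*) (deg : ι → ℕ × ℕ) (α β : ℕ × ℕ)
    (_h : α ≤ β) : FreeMod F ι deg α →ₗ[F] FreeMod F ι deg β where
  toFun f i := if h' : deg i.1 ≤ α then f ⟨i.1, h'⟩ else 0
  map_add' f g := by funext i; by_cases h' : deg i.1 ≤ α <;> simp [h']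
  map_smul' c f := by funext i; by_cases h' : deg i.1 ≤ α <;> simp [h']

/-- For a 2-parameter persistence module given by spaces `V` and structure maps `φ`, the
subspace `im ᴹφ_{α−e₁}^α + im ᴹφ_{α−e₂}^α` of `V α`, with the convention that a summand is
`0` when `α − eᵢ` leaves `ℕ²`.  (`dim (V α / imSum α)` is the 0-th Betti number `β₀(α)`.) -/
def imSum (F : Type*) [Field F] (V : ℕ × ℕ → Type*) [∀ a, AddCommGroup (V a)]
    [∀ a, Module F (V a)] (φ : ∀ a b : ℕ × ℕ, a ≤ b → (V a →ₗ[F] V b)) (α : ℕ × ℕ) :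
    Submodule F (V α) :=
  (if 0 < α.1 then
      LinearMap.range (φ (α.1 - 1, α.2) α (by simp [Prod.le_def])) else ⊥) ⊔
  (if 0 < α.2 then
      LinearMap.range (φ (α.1, α.2 - 1) α (by simp [Prod.le_def])) else ⊥)

lemma le_add_e1 (α : ℕ × ℕ) : α ≤ α + (1, 0) := by simp [Prod.le_def]

lemma le_add_e2 (α : ℕ × ℕ) : α ≤ α + (0, 1) := by simp [Prod.le_def]

section

variable {F : Type*} [Field F] {ι : Type*} {deg : ι → ℕ × ℕ}

/-- Restriction of an element of a free module to the summands already present at a smaller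
grade; a retraction of `freeMap`. -/
def freeRes (F : Type*) [Field F] (ι : Type*) (deg : ι → ℕ × ℕ) (α β : ℕ × ℕ) (h : α ≤ β) :
    FreeMod F ι deg β →ₗ[F] FreeMod F ι deg α where
  toFun f i := f ⟨i.1, i.2.trans h⟩
  map_add' _ _ := rfl
  map_smul' _ _ := rfl

lemma freeRes_apply {α β : ℕ × ℕ} (h : α ≤ β) (f : FreeMod F ι deg β)
    (i : {i : ι // deg i ≤ α}) : freeRes F ι deg α β h f i = f ⟨i.1, i.2.trans h⟩ := rfl

lemma freeMap_apply {α β : ℕ × ℕ} (h : α ≤ β) (f : FreeMod F ι deg α)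
    (i : {i : ι // deg i ≤ β}) :
    freeMap F ι deg α β h f i = if h' : deg i.1 ≤ α then f ⟨i.1, h'⟩ else 0 := rfl

lemma freeRes_freeMap {α β : ℕ × ℕ} (h : α ≤ β) (f : FreeMod F ι deg α) :
    freeRes F ι deg α β h (freeMap F ι deg α β h f) = f := by
  funext i
  simp [freeRes_apply, freeMap_apply, i.2]

lemma freeMap_injective {α β : ℕ × ℕ} (h : α ≤ β) :
    Function.Injective (freeMap F ι deg α β h) :=
  Function.LeftInverse.injective (freeRes_freeMap h)

lemma freeMap_freeRes {α β : ℕ × ℕ} (h : α ≤ β) (f : FreeMod F ι deg β)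
    (hf : ∀ i, ¬ deg i.1 ≤ α → f i = 0) :
    freeMap F ι deg α β h (freeRes F ι deg α β h f) = f := by
  funext i
  by_cases hi : deg i.1 ≤ α
  · simp [freeRes_apply, freeMap_apply, hi]
  · simp [freeMap_apply, hi, hf i hi]

lemma freeMap_freeMap {α β δ : ℕ × ℕ} (h : α ≤ β) (h' : β ≤ δ) (f : FreeMod F ι deg α) :
    freeMap F ι deg β δ h' (freeMap F ι deg α β h f) =
      freeMap F ι deg α δ (h.trans h') f := by
  funext i
  by_cases hi : deg i.1 ≤ α
  · simp [freeMap_apply, hi, hi.trans h]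
  · simp [freeMap_apply, hi]

/-- Elements of `imSum` of a free module vanish on the generators born at the current grade. -/
lemma apply_eq_zero_of_mem_imSum {β : ℕ × ℕ} {y : FreeMod F ι deg β}
    (hy : y ∈ imSum F (FreeMod F ι deg) (freeMap F ι deg) β)
    (i : {i : ι // deg i ≤ β}) (hi : deg i.1 = β) : y i = 0 := by
  obtain ⟨u, hu, v, hv, rfl⟩ := Submodule.mem_sup.1 hy
  have h₁ : u i = 0 := by
    split_ifs at hu with h
    · obtain ⟨p, rfl⟩ := hu
      have : ¬ deg i.1 ≤ (β.1 - 1, β.2) := by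
        rw [hi, Prod.le_def]; simp only; omega
      simp [freeMap_apply, this]
    · simp [(Submodule.mem_bot F).1 hu]
  have h₂ : v i = 0 := by
    split_ifs at hv with h
    · obtain ⟨p, rfl⟩ := hv
      have : ¬ deg i.1 ≤ (β.1, β.2 - 1) := by
        rw [hi, Prod.le_def]; simp only; omega
      simp [freeMap_apply, this]
    · simp [(Submodule.mem_bot F).1 hv]
  simp [h₁, h₂]

/-- In a free module, an element supported on the generators born by `a` or by `b` is a sum of
elements coming from `a` and `b`. -/
lemma exists_freeMap_add_freeMap {a b c : ℕ × ℕ} (ha : a ≤ c) (hb : b ≤ c)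
    (y : FreeMod F ι deg c) (hy : ∀ i, ¬ deg i.1 ≤ a → ¬ deg i.1 ≤ b → y i = 0) :
    ∃ p q, y = freeMap F ι deg a c ha p + freeMap F ι deg b c hb q := by
  refine ⟨freeRes F ι deg a c ha y, freeRes F ι deg b c hb
    (y - freeMap F ι deg a c ha (freeRes F ι deg a c ha y)), ?_⟩
  rw [freeMap_freeRes hb]
  · abel
  · intro i hi
    by_cases hia : deg i.1 ≤ a
    · simp [freeMap_apply, freeRes_apply, hia]
    · simp [freeMap_apply, hia, hy i hia hi]

/-- A square of grades in which `α` is the meet of `a` and `b`: elements at `a` and `b` of a free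
module agreeing at `c` come from a common element at `α`. -/
lemma exists_freeMap_eq_of_freeMap_eq {α a b c : ℕ × ℕ} (hαa : α ≤ a) (hαb : α ≤ b)
    (ha : a ≤ c) (hb : b ≤ c) (hinf : ∀ d, d ≤ a → d ≤ b → d ≤ α)
    (p : FreeMod F ι deg a) (q : FreeMod F ι deg b)
    (hpq : freeMap F ι deg a c ha p = freeMap F ι deg b c hb q) :
    freeMap F ι deg α a hαa (freeRes F ι deg α a hαa p) = p ∧
      freeMap F ι deg α b hαb (freeRes F ι deg α a hαa p) = q := by
  have h₁ : freeMap F ι deg α a hαa (freeRes F ι deg α a hαa p) = p := by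
    refine freeMap_freeRes hαa p fun i hi => ?_
    have hib : ¬ deg i.1 ≤ b := fun hib => hi (hinf _ i.2 hib)
    have := congrFun hpq ⟨i.1, i.2.trans ha⟩
    simpa [freeMap_apply, i.2, hib] using this
  refine ⟨h₁, freeMap_injective hb ?_⟩
  rw [freeMap_freeMap, ← hpq, ← freeMap_freeMap hαa ha, h₁]

/-- In such a square, restricting to `a` an element coming from `b` factors through `α`. -/
lemma freeRes_freeMap_of_meet {α a b c : ℕ × ℕ} (hαa : α ≤ a) (hαb : α ≤ b)
    (ha : a ≤ c) (hb : b ≤ c) (hinf : ∀ d, d ≤ a → d ≤ b → d ≤ α) (q : FreeMod F ι deg b) :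
    freeRes F ι deg a c ha (freeMap F ι deg b c hb q) =
      freeMap F ι deg α a hαa (freeRes F ι deg α b hαb q) := by
  funext i
  by_cases hib : deg i.1 ≤ b
  · simp [freeMap_apply, freeRes_apply, hib, hinf _ i.2 hib]
  · have : ¬ deg i.1 ≤ α := fun h => hib (h.trans hαb)
    simp [freeMap_apply, freeRes_apply, hib, this]

/-- Extension by zero of a function on the generators of degree exactly `c`. -/
def freeTop (F : Type*) [Field F] (ι : Type*) (deg : ι → ℕ × ℕ) (c : ℕ × ℕ) :
    ({i : ι // deg i = c} → F) →ₗ[F] FreeMod F ι deg c where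
  toFun f i := if h : deg i.1 = c then f ⟨i.1, h⟩ else 0
  map_add' f g := by funext i; by_cases h : deg i.1 = c <;> simp [h]
  map_smul' r f := by funext i; by_cases h : deg i.1 = c <;> simp [h]

lemma freeTop_apply {c : ℕ × ℕ} (f : {i : ι // deg i = c} → F) (i : {i : ι // deg i ≤ c}) :
    freeTop F ι deg c f i = if h : deg i.1 = c then f ⟨i.1, h⟩ else 0 := rfl

end

/-- Let `M` be a finitely presented 2-parameter persistence module with a
minimal free resolution `0 → F₂ →d₂ F₁ →d₁ F₀ →γ M → 0` (each `Fⱼ` finitely generated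
free, `γ` surjective, `im d₁ = ker γ`, `im d₂ = ker d₁`, `d₂` injective, and minimality:
`ker γ ⊆ m·F₀`, `ker d₁ ⊆ m·F₁`). Then the second bigraded Betti number (the number of
generators of `F₂` in the given degree) satisfies
`β₂^M(α+e₁+e₂) = dim {w ∈ M_α : ᴹφ_α^{α+e₁} w = 0 and ᴹφ_α^{α+e₂} w = 0}` for all `α`;
in particular `β₂^M(β) = 0` whenever `β` has a zero coordinate. -/
theorem betti_two_formula (F : Type*) [Field F]
    (V : ℕ × ℕ → Type*) [∀ a, AddCommGroup (V a)] [∀ a, Module F (V a)]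
    [∀ a, FiniteDimensional F (V a)]
    (φ : ∀ a b : ℕ × ℕ, a ≤ b → (V a →ₗ[F] V b))
    (hid : ∀ (a : ℕ × ℕ) (x : V a), φ a a le_rfl x = x)
    (hcomp : ∀ (a b c : ℕ × ℕ) (hab : a ≤ b) (hbc : b ≤ c) (x : V a),
      φ b c hbc (φ a b hab x) = φ a c (le_trans hab hbc) x)
    (ι₀ : Type*) [Fintype ι₀] (deg₀ : ι₀ → ℕ × ℕ)
    (ι₁ : Type*) [Fintype ι₁] (deg₁ : ι₁ → ℕ × ℕ)
    (ι₂ : Type*) [Fintype ι₂] [DecidableEq ι₂] (deg₂ : ι₂ → ℕ × ℕ)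
    (γ : ∀ α : ℕ × ℕ, FreeMod F ι₀ deg₀ α →ₗ[F] V α)
    (d₁ : ∀ α : ℕ × ℕ, FreeMod F ι₁ deg₁ α →ₗ[F] FreeMod F ι₀ deg₀ α)
    (d₂ : ∀ α : ℕ × ℕ, FreeMod F ι₂ deg₂ α →ₗ[F] FreeMod F ι₁ deg₁ α)
    (hγsurj : ∀ α, Function.Surjective (γ α))
    (hγcomm : ∀ (a b : ℕ × ℕ) (h : a ≤ b) (x : FreeMod F ι₀ deg₀ a),
      γ b (freeMap F ι₀ deg₀ a b h x) = φ a b h (γ a x))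
    (hd₁comm : ∀ (a b : ℕ × ℕ) (h : a ≤ b) (x : FreeMod F ι₁ deg₁ a),
      d₁ b (freeMap F ι₁ deg₁ a b h x) = freeMap F ι₀ deg₀ a b h (d₁ a x))
    (hd₂comm : ∀ (a b : ℕ × ℕ) (h : a ≤ b) (x : FreeMod F ι₂ deg₂ a),
      d₂ b (freeMap F ι₂ deg₂ a b h x) = freeMap F ι₁ deg₁ a b h (d₂ a x))
    (hexact₁ : ∀ α, LinearMap.range (d₁ α) = LinearMap.ker (γ α))
    (hexact₂ : ∀ α, LinearMap.range (d₂ α) = LinearMap.ker (d₁ α))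
    (hd₂inj : ∀ α, Function.Injective (d₂ α))
    (hmin₀ : ∀ α, LinearMap.ker (γ α) ≤ imSum F (FreeMod F ι₀ deg₀) (freeMap F ι₀ deg₀) α)
    (hmin₁ : ∀ α, LinearMap.ker (d₁ α) ≤
      imSum F (FreeMod F ι₁ deg₁) (freeMap F ι₁ deg₁) α) :
    (∀ α : ℕ × ℕ,
        (Finset.univ.filter (fun i : ι₂ => deg₂ i = α + (1, 1))).card =
          Module.finrank F
            ↥(LinearMap.ker (φ α (α + (1, 0)) (le_add_e1 α)) ⊓
              LinearMap.ker (φ α (α + (0, 1)) (le_add_e2 α)))) ∧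
    (∀ β : ℕ × ℕ, β.1 = 0 ∨ β.2 = 0 →
        (Finset.univ.filter (fun i : ι₂ => deg₂ i = β)).card = 0) := by
  refine ⟨fun α => ?_, fun β hβ => ?_⟩
  · suffices H : ∀ (a b c : ℕ × ℕ) (hαa : α ≤ a) (hαb : α ≤ b), a ≤ c → b ≤ c →
        (∀ d, d ≤ a → d ≤ b → d ≤ α) → (∀ d, d ≤ c → ¬ d ≤ a → ¬ d ≤ b → d = c) →
        ¬ c ≤ a → ¬ c ≤ b →
        (Finset.univ.filter (fun i : ι₂ => deg₂ i = c)).card =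
          Module.finrank F ↥(LinearMap.ker (φ α a hαa) ⊓ LinearMap.ker (φ α b hαb)) by
      apply H
      · simp
      · simp
      · intro d h₁ h₂
        simp only [Prod.le_def, Prod.fst_add, Prod.snd_add] at *
        omega
      · intro d h₁ h₂ h₃
        simp only [Prod.le_def, Prod.ext_iff, Prod.fst_add, Prod.snd_add] at *
        omega
      · simp [Prod.le_def]
      · simp [Prod.le_def]
    intro a b c hαa hαb ha hb hinf hcov hna hnb
    have hγd : ∀ {δ} (u : FreeMod F ι₁ deg₁ δ), γ δ (d₁ δ u) = 0 := fun {δ} u =>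
      LinearMap.mem_ker.1 (hexact₁ δ ▸ LinearMap.mem_range_self (d₁ δ) u)
    have hdd : ∀ {δ} (u : FreeMod F ι₂ deg₂ δ), d₁ δ (d₂ δ u) = 0 := fun {δ} u =>
      LinearMap.mem_ker.1 (hexact₂ δ ▸ LinearMap.mem_range_self (d₂ δ) u)
    have hlift₁ : ∀ {δ} (x : FreeMod F ι₀ deg₀ δ), γ δ x = 0 → ∃ u, d₁ δ u = x :=
      fun {δ} x hx => LinearMap.mem_range.1 (hexact₁ δ ▸ LinearMap.mem_ker.2 hx)
    have hlift₂ : ∀ {δ} (y : FreeMod F ι₁ deg₁ δ), d₁ δ y = 0 → ∃ u, d₂ δ u = y :=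
      fun {δ} y hy => LinearMap.mem_range.1 (hexact₂ δ ▸ LinearMap.mem_ker.2 hy)
    let Ψ : FreeMod F ι₂ deg₂ c →ₗ[F] V α := γ α ∘ₗ freeRes F ι₀ deg₀ α a hαa ∘ₗ d₁ a ∘ₗ
      freeRes F ι₁ deg₁ a c ha ∘ₗ d₂ c
    have hΨ : ∀ z p q, d₂ c z = freeMap F ι₁ deg₁ a c ha p + freeMap F ι₁ deg₁ b c hb q →
        Ψ z = γ α (freeRes F ι₀ deg₀ α a hαa (d₁ a p)) := by
      intro z p q h
      simp only [Ψ, LinearMap.comp_apply]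
      rw [h, map_add, freeRes_freeMap, freeRes_freeMap_of_meet hαa hαb ha hb hinf, map_add,
        hd₁comm, map_add, freeRes_freeMap, map_add, hγd, add_zero]
    have hsplit : ∀ z, ∃ p q,
        d₂ c z = freeMap F ι₁ deg₁ a c ha p + freeMap F ι₁ deg₁ b c hb q := fun z =>
      exists_freeMap_add_freeMap ha hb _ fun i h₁ h₂ =>
        apply_eq_zero_of_mem_imSum (hmin₁ c (LinearMap.mem_ker.2 (hdd z))) i
          (hcov _ i.2 h₁ h₂)
    have hglue : ∀ z p q,
        d₂ c z = freeMap F ι₁ deg₁ a c ha p + freeMap F ι₁ deg₁ b c hb q →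
        freeMap F ι₀ deg₀ α a hαa (freeRes F ι₀ deg₀ α a hαa (d₁ a p)) = d₁ a p ∧
        freeMap F ι₀ deg₀ α b hαb (freeRes F ι₀ deg₀ α a hαa (d₁ a p)) = d₁ b (-q) := by
      intro z p q h
      refine exists_freeMap_eq_of_freeMap_eq hαa hαb ha hb hinf _ _ ?_
      have := hdd z
      rw [h, map_add, hd₁comm, hd₁comm] at this
      rw [map_neg, map_neg]
      exact eq_neg_of_add_eq_zero_left this
    have hker : ∀ z, Ψ z = 0 → ∀ i, deg₂ i.1 = c → z i = 0 := by
      intro z hz i hi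
      obtain ⟨p, q, hpq⟩ := hsplit z
      obtain ⟨h₁, h₂⟩ := hglue z p q hpq
      rw [hΨ z p q hpq] at hz
      obtain ⟨u, hu⟩ := hlift₁ _ hz
      rw [← hu, ← hd₁comm] at h₁ h₂
      obtain ⟨v, hv⟩ := hlift₂ (p - freeMap F ι₁ deg₁ α a hαa u) (by rw [map_sub, h₁, sub_self])
      obtain ⟨v', hv'⟩ := hlift₂ (q + freeMap F ι₁ deg₁ α b hαb u)
        (by rw [map_add, h₂, map_neg, add_neg_cancel])
      have hzv : z = freeMap F ι₂ deg₂ a c ha v + freeMap F ι₂ deg₂ b c hb v' := by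
        apply hd₂inj c
        rw [hpq, map_add, hd₂comm, hd₂comm, hv, hv', map_sub, map_add, freeMap_freeMap,
          freeMap_freeMap]
        abel
      rw [hzv]
      simp [freeMap_apply, hi, hna, hnb]
    have hzero : ∀ z : FreeMod F ι₂ deg₂ c, (∀ i, deg₂ i.1 = c → z i = 0) → Ψ z = 0 := by
      intro z hz
      obtain ⟨v, v', rfl⟩ := exists_freeMap_add_freeMap ha hb z
        fun i h₁ h₂ => hz i (hcov _ i.2 h₁ h₂)
      rw [hΨ _ (d₂ a v) (d₂ b v') (by rw [map_add, hd₂comm, hd₂comm]), hdd, map_zero, map_zero]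
    have hinj : Function.Injective (Ψ ∘ₗ freeTop F ι₂ deg₂ c) := by
      refine (injective_iff_map_eq_zero _).2 fun f hf => ?_
      funext i
      have := hker _ hf ⟨i.1, i.2.le⟩ i.2
      simpa [freeTop_apply, i.2] using this
    have hrange : LinearMap.range (Ψ ∘ₗ freeTop F ι₂ deg₂ c) =
        LinearMap.ker (φ α a hαa) ⊓ LinearMap.ker (φ α b hαb) := by
      apply le_antisymm
      · rintro _ ⟨f, rfl⟩
        rw [LinearMap.comp_apply]
        obtain ⟨p, q, hpq⟩ := hsplit (freeTop F ι₂ deg₂ c f)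
        obtain ⟨h₁, h₂⟩ := hglue _ p q hpq
        rw [hΨ _ p q hpq]
        refine ⟨LinearMap.mem_ker.2 ?_, LinearMap.mem_ker.2 ?_⟩
        · rw [← hγcomm, h₁, hγd]
        · rw [← hγcomm, h₂, hγd]
      · rintro w ⟨hwa, hwb⟩
        obtain ⟨x, rfl⟩ := hγsurj α w
        have hwa := LinearMap.mem_ker.1 hwa
        have hwb := LinearMap.mem_ker.1 hwb
        rw [← hγcomm] at hwa hwb
        obtain ⟨p, hp⟩ := hlift₁ _ hwa
        obtain ⟨q, hq⟩ := hlift₁ _ hwb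
        obtain ⟨z, hz⟩ := hlift₂
          (freeMap F ι₁ deg₁ a c ha p + freeMap F ι₁ deg₁ b c hb (-q)) (by
            rw [map_add, hd₁comm, hd₁comm, map_neg, map_neg, hp, hq, freeMap_freeMap,
              freeMap_freeMap, add_neg_cancel])
        refine ⟨fun i => z ⟨i.1, i.2.le⟩, ?_⟩
        rw [LinearMap.comp_apply]
        have hx : Ψ z = γ α x := by rw [hΨ z p (-q) hz, hp, freeRes_freeMap]
        rw [← hx, ← sub_eq_zero, ← map_sub]
        apply hzero
        intro i hi
        simp [freeTop_apply, hi]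
    rw [← hrange, LinearMap.finrank_range_of_inj hinj, Module.finrank_fintype_fun_eq_card,
      Fintype.card_subtype]
  · rw [Finset.card_eq_zero, Finset.filter_eq_empty_iff]
    intro i _ hi
    obtain ⟨b, hb, hcov, hnb⟩ | hβ0 : (∃ b, ∃ _ : b ≤ β,
        (∀ d, d ≤ β → ¬ d ≤ b → d = β) ∧ ¬ β ≤ b) ∨ ∀ d, d ≤ β → d = β := by
      obtain ⟨m, n⟩ := β
      by_cases h0 : m = 0 ∧ n = 0
      · right
        rintro ⟨d, e⟩ h
        simp only [Prod.le_def, Prod.ext_iff] at *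
        omega
      · left
        refine ⟨(m - 1, n - 1), by simp [Prod.le_def], ?_, ?_⟩
        · rintro ⟨d, e⟩ h h'
          simp only [Prod.le_def, Prod.ext_iff] at *
          omega
        · simp only [Prod.le_def] at *
          omega
    · let e : FreeMod F ι₂ deg₂ β := Pi.single ⟨i, hi.le⟩ 1
      have he : d₂ β e ∈ LinearMap.ker (d₁ β) := hexact₂ β ▸ LinearMap.mem_range_self _ e
      have hy := freeMap_freeRes hb (d₂ β e) fun j hj =>
        apply_eq_zero_of_mem_imSum (hmin₁ β he) j (hcov _ j.2 hj)
      have hy0 : freeRes F ι₁ deg₁ b β hb (d₂ β e) ∈ LinearMap.ker (d₁ b) := by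
        rw [LinearMap.mem_ker]
        apply freeMap_injective hb
        rw [← hd₁comm, hy, map_zero]
        exact he
      rw [← hexact₂] at hy0
      obtain ⟨v, hv⟩ := hy0
      rw [← hv, ← hd₂comm] at hy
      have := congrFun (hd₂inj β hy) ⟨i, hi.le⟩
      simp [freeMap_apply, hi, hnb, e] at this
    · let e : FreeMod F ι₂ deg₂ β := Pi.single ⟨i, hi.le⟩ 1
      have he : d₂ β e ∈ LinearMap.ker (d₁ β) := hexact₂ β ▸ LinearMap.mem_range_self _ e
      have hy : d₂ β e = d₂ β 0 := by
        rw [map_zero]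
        funext j
        exact apply_eq_zero_of_mem_imSum (hmin₁ β he) j (hβ0 _ j.2)
      have := congrFun (hd₂inj β hy) ⟨i, hi.le⟩
      simp [e] at this
end

section
/- Let M be a finitely presented 2-parameter persistence module. Then β₀^M(α) equals the multiplicity of the zero-length bar [α,α] in the barcode of the into-α frame of M, i.e., the zigzag module M_{α−e₁} → M_α ← M_{α−e₂} (with the convention that M_β = 0 if β has a negative coordinate). Equivalently, β₀^M(α) = dim(M_α / (im ᴹφ_{α−e₁}^α + im ᴹφ_{α−e₂}^α)). -/
/-- A surjective morphism of persistence modules maps `imSum` onto `imSum`. -/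
theorem map_imSum {F : Type*} [Field F] {U V : ℕ × ℕ → Type*}
    [∀ a, AddCommGroup (U a)] [∀ a, Module F (U a)]
    [∀ a, AddCommGroup (V a)] [∀ a, Module F (V a)]
    (ψ : ∀ a b : ℕ × ℕ, a ≤ b → (U a →ₗ[F] U b))
    (φ : ∀ a b : ℕ × ℕ, a ≤ b → (V a →ₗ[F] V b))
    (γ : ∀ a, U a →ₗ[F] V a) (hsurj : ∀ a, Function.Surjective (γ a))
    (hcomm : ∀ (a b : ℕ × ℕ) (h : a ≤ b) (x : U a), γ b (ψ a b h x) = φ a b h (γ a x))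
    (α : ℕ × ℕ) :
    (imSum F U ψ α).map (γ α) = imSum F V φ α := by
  have map_range (a b : ℕ × ℕ) (h : a ≤ b) :
      (LinearMap.range (ψ a b h)).map (γ b) = LinearMap.range (φ a b h) := by
    have hc : γ b ∘ₗ ψ a b h = φ a b h ∘ₗ γ a := LinearMap.ext (hcomm a b h)
    rw [← LinearMap.range_comp, hc,
      LinearMap.range_comp_of_range_eq_top _ (LinearMap.range_eq_top.2 (hsurj a))]
  unfold imSum
  rw [Submodule.map_sup]
  congr 1 <;> split_ifs <;> simp only [map_range, Submodule.map_bot]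

/-- Restriction of an element of the free module at grade `α` to the generators born at `α`. -/
def bornRestrict (F : Type*) [Field F] {ι : Type*} (deg : ι → ℕ × ℕ) (α : ℕ × ℕ) :
    FreeMod F ι deg α →ₗ[F] ({i : ι // deg i = α} → F) :=
  LinearMap.funLeft F F fun i => ⟨i.1, i.2.le⟩

theorem bornRestrict_surjective (F : Type*) [Field F] {ι : Type*} (deg : ι → ℕ × ℕ)
    (α : ℕ × ℕ) : Function.Surjective (bornRestrict F deg α) :=
  LinearMap.funLeft_surjective_of_injective F F _ fun _ _ h =>
    Subtype.ext (congrArg (fun k : {i : ι // deg i ≤ α} => k.1) h)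

theorem range_freeMap_le_ker_bornRestrict (F : Type*) [Field F] {ι : Type*}
    (deg : ι → ℕ × ℕ) {a α : ℕ × ℕ} (h : a ≤ α) (hne : a ≠ α) :
    LinearMap.range (freeMap F ι deg a α h) ≤ LinearMap.ker (bornRestrict F deg α) := by
  rintro _ ⟨f, rfl⟩
  rw [LinearMap.mem_ker]
  funext i
  have hi : ¬ deg i.1 ≤ a := fun hle => hne (le_antisymm h (i.2 ▸ hle))
  simp [bornRestrict, freeMap, LinearMap.funLeft_apply, hi]

theorem mem_range_freeMap (F : Type*) [Field F] {ι : Type*} (deg : ι → ℕ × ℕ)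
    {a α : ℕ × ℕ} (h : a ≤ α) (f : FreeMod F ι deg α)
    (hf : ∀ i, ¬ deg i.1 ≤ a → f i = 0) : f ∈ LinearMap.range (freeMap F ι deg a α h) := by
  refine ⟨fun i => f ⟨i.1, i.2.trans h⟩, ?_⟩
  funext i
  by_cases hi : deg i.1 ≤ a <;> simp [freeMap, hi, hf]

theorem imSum_freeMap (F : Type*) [Field F] {ι : Type*} (deg : ι → ℕ × ℕ) (α : ℕ × ℕ) :
    imSum F (FreeMod F ι deg) (freeMap F ι deg) α = LinearMap.ker (bornRestrict F deg α) := by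
  apply le_antisymm
  · unfold imSum
    refine sup_le ?_ ?_ <;> split_ifs with h
    · exact range_freeMap_le_ker_bornRestrict F deg _ fun e => by
        have := congrArg Prod.fst e
        simp only at this
        omega
    · exact bot_le
    · exact range_freeMap_le_ker_bornRestrict F deg _ fun e => by
        have := congrArg Prod.snd e
        simp only at this
        omega
    · exact bot_le
  · intro f hf
    have hborn (i : {i : ι // deg i ≤ α}) (hi : deg i.1 = α) : f i = 0 :=
      congrFun (LinearMap.mem_ker.1 hf) ⟨i.1, hi⟩
    let g : FreeMod F ι deg α := fun i => if (deg i.1).1 < α.1 then f i else 0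
    rw [← add_sub_cancel g f]
    unfold imSum
    refine Submodule.add_mem_sup ?_ ?_ <;> split_ifs with h
    · refine mem_range_freeMap F deg _ _ fun i hi => if_neg fun hlt => hi ?_
      exact Prod.le_def.2 ⟨Nat.le_sub_one_of_lt hlt, i.2.2⟩
    · rw [Submodule.mem_bot]
      funext i
      exact if_neg fun hlt => h (by omega)
    · refine mem_range_freeMap F deg _ _ fun i hi => ?_
      by_cases hlt : (deg i.1).1 < α.1
      · simp [g, hlt]
      · have hi1 := i.2.1
        have hi2 := i.2.2
        have hz : f i = 0 := hborn i <| by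
          by_contra hne
          refine hi (Prod.le_def.2 ⟨hi1, Nat.le_sub_one_of_lt (lt_of_le_of_ne hi2 fun e => ?_)⟩)
          exact hne (Prod.ext (by omega) e)
        simp [g, hlt, hz]
    · rw [Submodule.mem_bot]
      funext i
      by_cases hlt : (deg i.1).1 < α.1
      · simp [g, hlt]
      · have hi1 := i.2.1
        have hi2 := i.2.2
        simp [g, hlt, hborn i (Prod.ext (by omega) (by omega))]

/-- Let `M` be a finitely presented 2-parameter persistence module, with a
minimal free cover `γ : F₀ ↠ M` (surjective in each grade, commuting with structure maps,
with `ker γ ⊆ m·F₀`, so that the generators of `F₀` count the minimal generators of `M`).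
Then `β₀^M(α)`, the number of generators of `F₀` in degree `α`, equals the multiplicity of
the bar `[α,α]` in the barcode of the into-`α` frame `M_{α−e₁} → M_α ← M_{α−e₂}`, i.e.
`dim (M_α / (im ᴹφ_{α−e₁}^α + im ᴹφ_{α−e₂}^α))`. -/
theorem betti_zero_eq_coker (F : Type*) [Field F]
    (V : ℕ × ℕ → Type*) [∀ a, AddCommGroup (V a)] [∀ a, Module F (V a)]
    [∀ a, FiniteDimensional F (V a)]
    (φ : ∀ a b : ℕ × ℕ, a ≤ b → (V a →ₗ[F] V b))
    (hid : ∀ (a : ℕ × ℕ) (x : V a), φ a a le_rfl x = x)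
    (hcomp : ∀ (a b c : ℕ × ℕ) (hab : a ≤ b) (hbc : b ≤ c) (x : V a),
      φ b c hbc (φ a b hab x) = φ a c (le_trans hab hbc) x)
    (ι₀ : Type*) [Fintype ι₀] [DecidableEq ι₀] (deg₀ : ι₀ → ℕ × ℕ)
    (γ : ∀ α : ℕ × ℕ, FreeMod F ι₀ deg₀ α →ₗ[F] V α)
    (hγsurj : ∀ α, Function.Surjective (γ α))
    (hγcomm : ∀ (a b : ℕ × ℕ) (h : a ≤ b) (x : FreeMod F ι₀ deg₀ a),
      γ b (freeMap F ι₀ deg₀ a b h x) = φ a b h (γ a x))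
    (hmin : ∀ α, LinearMap.ker (γ α) ≤ imSum F (FreeMod F ι₀ deg₀) (freeMap F ι₀ deg₀) α)
    (α : ℕ × ℕ) :
    (Finset.univ.filter (fun i : ι₀ => deg₀ i = α)).card =
      Module.finrank F (V α ⧸ imSum F V φ α) := by
  have hker : LinearMap.ker ((imSum F V φ α).mkQ ∘ₗ γ α) =
      LinearMap.ker (bornRestrict F deg₀ α) := by
    rw [LinearMap.ker_comp, Submodule.ker_mkQ,
      ← map_imSum (freeMap F ι₀ deg₀) φ γ hγsurj hγcomm, Submodule.comap_map_eq,
      sup_eq_left.2 (hmin α), imSum_freeMap]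
  have e := ((LinearMap.quotKerEquivOfSurjective ((imSum F V φ α).mkQ ∘ₗ γ α)
      ((Submodule.mkQ_surjective (imSum F V φ α)).comp (hγsurj α))).symm.trans
    (Submodule.quotEquivOfEq _ _ hker)).trans
    (LinearMap.quotKerEquivOfSurjective (bornRestrict F deg₀ α)
      (bornRestrict_surjective F deg₀ α))
  rw [e.finrank_eq, Module.finrank_fintype_fun_eq_card, Fintype.card_subtype]
end
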